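/- Let n ≥ 1, σ > 0, c > 0, R₀ > 0, let s, ϱ ∈ ℝ with s + ϱ > 0, and let α ∈ [1, ∞). Then there exists a constant C > 0 such that for every family (f_q)_{q∈ℤ} of Schwartz functions on ℝⁿ with supp \hat{f_q} ⊆ A_q for every q and with M := sup_{q∈ℤ} 2^{−qϱ}‖f_q‖_{L²(ℝⁿ)} < ∞, and every t ≥ 0: ( Σ_{q ∈ ℤ, 2^q ≤ R₀} ( 2^{qs} ‖\hat{f_q}(·) e^{−c |·|^{σ} t}‖_{L²(ℝⁿ)} )^α )^{1/α} ≤ C M (1+t)^{−(s+ϱ)/σ}. -/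

import Mathlib

open MeasureTheory Real
open scoped FourierTransform ENNReal NNReal

noncomputable section

/-- Plancherel's theorem for Schwartz functions, in terms of `eLpNorm`. -/
theorem SchwartzMap.eLpNorm_fourier_two {V : Type*} [NormedAddCommGroup V]
    [InnerProductSpace ℝ V] [FiniteDimensional ℝ V] [MeasurableSpace V] [BorelSpace V]
    (f : SchwartzMap V ℂ) :
    eLpNorm (𝓕 (⇑f)) 2 volume = eLpNorm (⇑f) 2 volume := by
  have h := f.norm_fourier_toL2_eq
  rw [SchwartzMap.norm_toLp, SchwartzMap.norm_toLp, ENNReal.toReal_eq_toReal_iff'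
    ((𝓕 f).memLp 2 volume).eLpNorm_ne_top (f.memLp 2 volume).eLpNorm_ne_top] at h
  exact h

/-- Powers are dominated by exponentials on `[1, ∞)`. -/
theorem exists_forall_one_le_rpow_mul_exp_neg_le {κ : ℝ} (hκ : 0 < κ) (b : ℝ) :
    ∃ K : ℝ, 0 < K ∧ ∀ y : ℝ, 1 ≤ y → y ^ b * Real.exp (-(κ * y)) ≤ K := by
  obtain ⟨N, hN⟩ := exists_nat_ge b
  refine ⟨N.factorial / κ ^ N, by positivity, fun y hy => ?_⟩
  have hy0 : 0 < y := by linarith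
  have h1 : y ^ b ≤ y ^ N := by
    rw [← Real.rpow_natCast y N]
    exact Real.rpow_le_rpow_of_exponent_le hy hN
  have h2 := Real.pow_div_factorial_le_exp (x := κ * y) (by positivity) N
  rw [Real.exp_neg, ← div_eq_mul_inv, div_le_div_iff₀ (Real.exp_pos _) (by positivity)]
  rw [div_le_iff₀ (by positivity), mul_pow] at h2
  calc y ^ b * κ ^ N ≤ y ^ N * κ ^ N := by gcongr
    _ ≤ _ := by linarith

/-- A power times an exponential in the dyadic variable decays geometrically in both directions. -/
theorem exists_two_rpow_mul_exp_neg_le {κ σ a : ℝ} (hκ : 0 < κ) (hσ : 0 < σ) (ha : 0 < a) :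
    ∃ K : ℝ, 0 < K ∧ ∀ u : ℝ,
      (2 : ℝ) ^ (u * a) * Real.exp (-(κ * 2 ^ (u * σ))) ≤ K * 2 ^ (-(a * |u|)) := by
  obtain ⟨K, hK, h⟩ := exists_forall_one_le_rpow_mul_exp_neg_le hκ (2 * a / σ)
  refine ⟨max K 1, by positivity, fun u => ?_⟩
  rcases le_total u 0 with hu | hu
  · have hexp : Real.exp (-(κ * 2 ^ (u * σ))) ≤ 1 := by
      rw [Real.exp_le_one_iff, neg_nonpos]; positivity
    rw [abs_of_nonpos hu, mul_comm (max K 1), show -(a * -u) = u * a by ring]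
    gcongr
    exact hexp.trans (le_max_right _ _)
  · have hy := h (2 ^ (u * σ)) (Real.one_le_rpow one_le_two (by positivity))
    rw [← Real.rpow_mul zero_le_two, show u * σ * (2 * a / σ) = u * a + u * a by
      field_simp; ring, Real.rpow_add two_pos] at hy
    rw [abs_of_nonneg hu, Real.rpow_neg zero_le_two, mul_comm a, ← div_eq_mul_inv,
      le_div_iff₀ (by positivity)]
    exact le_trans (by linarith) (le_max_left K 1)

/-- Uniformly in the time scale `T`, dyadically sampled dissipation decays geometrically away from
the critical frequency `T ^ (-1 / σ)`. -/
theorem exists_shift_two_rpow_mul_exp_neg_le {κ σ a : ℝ} (hκ : 0 < κ) (hσ : 0 < σ) (ha : 0 < a) :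
    ∃ K : ℝ, 0 < K ∧ ∀ T : ℝ, 0 < T → ∃ j : ℤ, ∀ q : ℤ,
      (2 : ℝ) ^ ((q : ℝ) * a) * Real.exp (-(κ * 2 ^ ((q : ℝ) * σ) * T)) ≤
        K * 2 ^ (-(a * |((q + j : ℤ) : ℝ)|)) * T ^ (-a / σ) := by
  obtain ⟨K, hK, h⟩ := exists_two_rpow_mul_exp_neg_le hκ hσ ha
  refine ⟨K * 2 ^ a, by positivity, fun T hT => ?_⟩
  set τ := Real.logb 2 T / σ with hτ
  have hT2 : T = 2 ^ (τ * σ) := by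
    rw [hτ, div_mul_cancel₀ _ hσ.ne', Real.rpow_logb two_pos (by norm_num) hT]
  refine ⟨⌊τ⌋, fun q => ?_⟩
  have hu := h (q + τ)
  have habs : |((q + ⌊τ⌋ : ℤ) : ℝ)| ≤ |(q : ℝ) + τ| + 1 := by
    have h1 := Int.floor_le τ
    have h2 := Int.lt_floor_add_one τ
    have h3 := abs_sub_abs_le_abs_sub (((q + ⌊τ⌋ : ℤ) : ℝ)) ((q : ℝ) + τ)
    have h4 : |(((q + ⌊τ⌋ : ℤ) : ℝ)) - ((q : ℝ) + τ)| ≤ 1 := by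
      push_cast
      rw [abs_le]; constructor <;> linarith
    linarith
  have hpow : T ^ (-a / σ) = 2 ^ (-(τ * a)) := by
    rw [hT2, ← Real.rpow_mul zero_le_two]; congr 1; field_simp
  have harg : κ * 2 ^ ((q : ℝ) * σ) * T = κ * 2 ^ (((q : ℝ) + τ) * σ) := by
    rw [add_mul, Real.rpow_add two_pos, ← hT2, mul_assoc]
  have hsplit : (2 : ℝ) ^ ((q : ℝ) * a) = 2 ^ (((q : ℝ) + τ) * a) * 2 ^ (-(τ * a)) := by
    rw [← Real.rpow_add two_pos]; congr 1; ring
  have hshift : (2 : ℝ) ^ (-(a * |(q : ℝ) + τ|)) ≤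
      2 ^ a * 2 ^ (-(a * |((q + ⌊τ⌋ : ℤ) : ℝ)|)) := by
    rw [← Real.rpow_add two_pos]
    apply Real.rpow_le_rpow_of_exponent_le one_le_two
    nlinarith
  rw [hpow, harg, hsplit, mul_right_comm]
  refine mul_le_mul_of_nonneg_right (hu.trans ?_) (by positivity)
  rw [mul_assoc]
  gcongr

/-- Two-sided geometric sums over `ℤ` are finite. -/
theorem tsum_ofReal_two_rpow_neg_mul_abs_ne_top {b : ℝ} (hb : 0 < b) :
    ∑' q : ℤ, ENNReal.ofReal ((2 : ℝ) ^ (-(b * |(q : ℝ)|))) ≠ ⊤ := by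
  have hgeo : Summable fun k : ℕ => ((2 : ℝ) ^ (-b)) ^ k :=
    summable_geometric_of_lt_one (by positivity)
      (Real.rpow_lt_one_of_one_lt_of_neg one_lt_two (by linarith))
  have hnat : Summable fun k : ℕ => (2 : ℝ) ^ (-(b * (k : ℝ))) := by
    refine hgeo.congr fun k => ?_
    rw [← Real.rpow_natCast, ← Real.rpow_mul zero_le_two, neg_mul]
  have hsum : Summable fun q : ℤ => (2 : ℝ) ^ (-(b * |(q : ℝ)|)) := by
    apply Summable.of_nat_of_neg <;> simpa using hnat
  rw [← ENNReal.ofReal_tsum_of_nonneg (fun q => by positivity) hsum]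
  exact ENNReal.ofReal_ne_top

/-- Plancherel and the lower bound on the spectrum: the dissipative multiplier `e^{-c|ξ|^σ t}`
damps a function whose spectrum avoids a ball. -/
theorem eLpNorm_exp_smul_fourier_le {V : Type*} [NormedAddCommGroup V]
    [InnerProductSpace ℝ V] [FiniteDimensional ℝ V] [MeasurableSpace V] [BorelSpace V]
    {σ c r t : ℝ} (hσ : 0 ≤ σ) (hc : 0 ≤ c) (hr : 0 ≤ r) (ht : 0 ≤ t) (f : SchwartzMap V ℂ)
    (hf : Function.support (𝓕 ⇑f) ⊆ {ξ | r ≤ ‖ξ‖}) :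
    eLpNorm (fun ξ => Real.exp (-(c * ‖ξ‖ ^ σ) * t) • 𝓕 (⇑f) ξ) 2 volume ≤
      ENNReal.ofReal (Real.exp (-(c * r ^ σ * t))) * eLpNorm (⇑f) 2 volume := by
  rw [← f.eLpNorm_fourier_two]
  refine eLpNorm_le_mul_eLpNorm_of_ae_le_mul (.of_forall fun ξ => ?_) 2
  by_cases hξ : 𝓕 (⇑f) ξ = 0
  · simp [hξ]
  have hr' : r ≤ ‖ξ‖ := hf hξ
  rw [norm_smul, Real.norm_of_nonneg (Real.exp_pos _).le, neg_mul]
  gcongr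

/-- The summed low-frequency half of the frequency-localization time-decay inequality of
Theorem 1.1 (estimates (R-E23)-(R-E25)), for a dissipative rate behaving like `c|ξ|^σ`
at low frequencies; `M` is the `Ḃ^{-ϱ}_{2,∞}` norm of the data. -/
theorem summed_low_freq_decay
    (n : ℕ) (hn : 1 ≤ n) (σ c R₀ : ℝ) (hσ : 0 < σ) (hc : 0 < c) (hR₀ : 0 < R₀)
    (s ϱ : ℝ) (hsϱ : 0 < s + ϱ) (α : ℝ) (hα : 1 ≤ α) :
    ∃ C : ℝ≥0, 0 < C ∧
      ∀ f : ℤ → SchwartzMap (EuclideanSpace ℝ (Fin n)) ℂ,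
        (∀ q : ℤ, Function.support (𝓕 ⇑(f q)) ⊆
          {ξ : EuclideanSpace ℝ (Fin n) | (3 / 4 : ℝ) * 2 ^ q ≤ ‖ξ‖ ∧ ‖ξ‖ ≤ (8 / 3 : ℝ) * 2 ^ q}) →
        (⨆ q : ℤ, (2 : ℝ≥0∞) ^ (-(q : ℝ) * ϱ) * eLpNorm (⇑(f q)) 2 volume) ≠ ⊤ →
        ∀ t : ℝ, 0 ≤ t →
          (∑' q : {q : ℤ // (2 : ℝ) ^ q ≤ R₀}, ((2 : ℝ≥0∞) ^ ((q.1 : ℝ) * s) *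
              eLpNorm (fun ξ : EuclideanSpace ℝ (Fin n) =>
                Real.exp (-(c * ‖ξ‖ ^ σ) * t) • 𝓕 (⇑(f q.1)) ξ) 2 volume) ^ α) ^ (1 / α)
            ≤ C * (⨆ q : ℤ, (2 : ℝ≥0∞) ^ (-(q : ℝ) * ϱ) * eLpNorm (⇑(f q)) 2 volume) *
                ENNReal.ofReal ((1 + t) ^ (-(s + ϱ) / σ)) := by
  have ha : 0 < s + ϱ := hsϱ
  have hα0 : 0 < α := by linarith
  set κ : ℝ := c * (3 / 4) ^ σ with hκdef
  have hκ : 0 < κ := by positivity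
  obtain ⟨K, hK, hdecay⟩ := exists_shift_two_rpow_mul_exp_neg_le hκ hσ ha
  set L : ℝ := Real.exp (κ * R₀ ^ σ) with hL
  set S : ℝ≥0∞ := ∑' q : ℤ, ENNReal.ofReal ((2 : ℝ) ^ (-((s + ϱ) * α * |(q : ℝ)|))) with hS
  have hS_top : S ≠ ⊤ := tsum_ofReal_two_rpow_neg_mul_abs_ne_top (by positivity)
  set B : ℝ≥0∞ := ENNReal.ofReal (L * K) * S ^ (1 / α) with hB
  have hB_top : B ≠ ⊤ :=
    ENNReal.mul_ne_top ENNReal.ofReal_ne_top (ENNReal.rpow_ne_top_of_nonneg (by positivity) hS_top)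
  refine ⟨B.toNNReal + 1, by positivity, fun f hf _ t ht => ?_⟩
  set M : ℝ≥0∞ := ⨆ q : ℤ, (2 : ℝ≥0∞) ^ (-(q : ℝ) * ϱ) * eLpNorm (⇑(f q)) 2 volume with hM
  obtain ⟨j, hj⟩ := hdecay (1 + t) (by linarith)
  set D : ℝ := (1 + t) ^ (-(s + ϱ) / σ) with hD
  have hD0 : 0 ≤ D := by positivity
  have two_rpow (x : ℝ) : (2 : ℝ≥0∞) ^ x = ENNReal.ofReal ((2 : ℝ) ^ x) := by
    rw [← ENNReal.ofReal_rpow_of_pos two_pos, ENNReal.ofReal_ofNat]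
  have data_le (q : ℤ) : eLpNorm (⇑(f q)) 2 volume ≤ (2 : ℝ≥0∞) ^ ((q : ℝ) * ϱ) * M := by
    calc eLpNorm (⇑(f q)) 2 volume
        = (2 : ℝ≥0∞) ^ ((q : ℝ) * ϱ) *
            ((2 : ℝ≥0∞) ^ (-(q : ℝ) * ϱ) * eLpNorm (⇑(f q)) 2 volume) := by
          rw [← mul_assoc, ← ENNReal.rpow_add _ _ two_ne_zero ENNReal.ofNat_ne_top]
          simp
      _ ≤ _ := by
          gcongr
          exact le_iSup (fun q : ℤ =>
            (2 : ℝ≥0∞) ^ (-(q : ℝ) * ϱ) * eLpNorm (⇑(f q)) 2 volume) q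
  have weight_le (q : ℤ) (hq : (2 : ℝ) ^ q ≤ R₀) :
      (2 : ℝ) ^ ((q : ℝ) * (s + ϱ)) * Real.exp (-(c * (3 / 4 * 2 ^ q) ^ σ * t)) ≤
        L * K * D * 2 ^ (-((s + ϱ) * |((q + j : ℤ) : ℝ)|)) := by
    have hpow : c * (3 / 4 * 2 ^ q) ^ σ = κ * 2 ^ ((q : ℝ) * σ) := by
      rw [Real.mul_rpow (by norm_num) (by positivity), Real.rpow_mul zero_le_two,
        Real.rpow_intCast, ← mul_assoc]
    have hexp : Real.exp (-(κ * 2 ^ ((q : ℝ) * σ) * t)) ≤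
        L * Real.exp (-(κ * 2 ^ ((q : ℝ) * σ) * (1 + t))) := by
      rw [hL, ← Real.exp_add, Real.exp_le_exp]
      have : (2 : ℝ) ^ ((q : ℝ) * σ) ≤ R₀ ^ σ := by
        rw [Real.rpow_mul zero_le_two, Real.rpow_intCast]
        gcongr
      nlinarith
    rw [hpow]
    calc (2 : ℝ) ^ ((q : ℝ) * (s + ϱ)) * Real.exp (-(κ * 2 ^ ((q : ℝ) * σ) * t))
        ≤ (2 : ℝ) ^ ((q : ℝ) * (s + ϱ)) *
            (L * Real.exp (-(κ * 2 ^ ((q : ℝ) * σ) * (1 + t)))) := by gcongr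
      _ = L * ((2 : ℝ) ^ ((q : ℝ) * (s + ϱ)) *
            Real.exp (-(κ * 2 ^ ((q : ℝ) * σ) * (1 + t)))) := by ring
      _ ≤ L * (K * 2 ^ (-((s + ϱ) * |((q + j : ℤ) : ℝ)|)) * D) := by
          exact mul_le_mul_of_nonneg_left (hj q) (Real.exp_pos _).le
      _ = _ := by ring
  have term_le (q : {q : ℤ // (2 : ℝ) ^ q ≤ R₀}) :
      ((2 : ℝ≥0∞) ^ ((q.1 : ℝ) * s) *
        eLpNorm (fun ξ : EuclideanSpace ℝ (Fin n) =>
          Real.exp (-(c * ‖ξ‖ ^ σ) * t) • 𝓕 (⇑(f q.1)) ξ) 2 volume) ^ α ≤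
      (ENNReal.ofReal (L * K * D) * M) ^ α *
        ENNReal.ofReal ((2 : ℝ) ^ (-((s + ϱ) * α * |((q.1 + j : ℤ) : ℝ)|))) := by
    have hpow : ENNReal.ofReal ((2 : ℝ) ^ (-((s + ϱ) * α * |((q.1 + j : ℤ) : ℝ)|))) =
        ENNReal.ofReal ((2 : ℝ) ^ (-((s + ϱ) * |((q.1 + j : ℤ) : ℝ)|))) ^ α := by
      rw [ENNReal.ofReal_rpow_of_nonneg (by positivity) hα0.le, ← Real.rpow_mul zero_le_two]
      congr 2; ring
    rw [hpow, ← ENNReal.mul_rpow_of_nonneg _ _ hα0.le]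
    refine ENNReal.rpow_le_rpow ?_ hα0.le
    have hmult := eLpNorm_exp_smul_fourier_le (t := t) hσ.le hc.le
      (r := 3 / 4 * 2 ^ q.1) (by positivity) ht (f q.1) (fun ξ hξ => (hf q.1 hξ).1)
    calc (2 : ℝ≥0∞) ^ ((q.1 : ℝ) * s) *
          eLpNorm (fun ξ : EuclideanSpace ℝ (Fin n) =>
            Real.exp (-(c * ‖ξ‖ ^ σ) * t) • 𝓕 (⇑(f q.1)) ξ) 2 volume
        ≤ (2 : ℝ≥0∞) ^ ((q.1 : ℝ) * s) *
            (ENNReal.ofReal (Real.exp (-(c * (3 / 4 * 2 ^ q.1) ^ σ * t))) *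
              ((2 : ℝ≥0∞) ^ ((q.1 : ℝ) * ϱ) * M)) := by
          gcongr
          exact hmult.trans (by gcongr; exact data_le q.1)
      _ = ENNReal.ofReal ((2 : ℝ) ^ ((q.1 : ℝ) * (s + ϱ)) *
            Real.exp (-(c * (3 / 4 * 2 ^ q.1) ^ σ * t))) * M := by
          rw [ENNReal.ofReal_mul (by positivity), ← two_rpow, mul_add,
            ENNReal.rpow_add _ _ two_ne_zero ENNReal.ofNat_ne_top]
          ring
      _ ≤ ENNReal.ofReal (L * K * D * 2 ^ (-((s + ϱ) * |((q.1 + j : ℤ) : ℝ)|))) * M := by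
          exact mul_le_mul_left (ENNReal.ofReal_le_ofReal (weight_le q.1 q.2)) M
      _ = _ := by
          rw [ENNReal.ofReal_mul (by positivity)]
          ring
  have sum_le : ∑' q : {q : ℤ // (2 : ℝ) ^ q ≤ R₀},
      ENNReal.ofReal ((2 : ℝ) ^ (-((s + ϱ) * α * |((q.1 + j : ℤ) : ℝ)|))) ≤ S :=
    ENNReal.tsum_comp_le_tsum_of_injective
      (f := fun q : {q : ℤ // (2 : ℝ) ^ q ≤ R₀} => q.1 + j)
      (fun p q hpq => Subtype.ext (add_right_cancel hpq))
      (fun q : ℤ => ENNReal.ofReal ((2 : ℝ) ^ (-((s + ϱ) * α * |(q : ℝ)|))))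
  calc _ ≤ ((ENNReal.ofReal (L * K * D) * M) ^ α * S) ^ (1 / α) := by
        refine ENNReal.rpow_le_rpow ?_ (by positivity)
        refine (ENNReal.tsum_le_tsum term_le).trans ?_
        rw [ENNReal.tsum_mul_left]
        gcongr
    _ = B * M * ENNReal.ofReal D := by
        rw [ENNReal.mul_rpow_of_nonneg _ _ (by positivity), one_div,
          ENNReal.rpow_rpow_inv hα0.ne', ENNReal.ofReal_mul (by positivity), hB, one_div]
        ring
    _ ≤ _ := by
        gcongr
        rw [ENNReal.coe_add, ENNReal.coe_toNNReal hB_top]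
        exact le_self_add
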